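/- Let f = x³z³ + y³z² + y² and g = x in ℚ[x,y,z]. For every b ∈ ℚ[s], b satisfies the Bernstein–Sato functional equation for the pair (f, g) if and only if (s + 5/6)(s + 1)(s + 7/6)²(s + 3/2)(s + 11/6) divides b in ℚ[s]; that is, b_{f,x}(s) = (s + 5/6)(s + 1)(s + 7/6)²(s + 3/2)(s + 11/6). -/

import Mathlib

open MvPolynomial Polynomial

/-- The iterated formal partial derivative `∂^α = ∏ᵢ ∂_{xᵢ}^{αᵢ}` applied to a
multivariate polynomial (the partial derivatives pairwise commute, so the order
of the fold is immaterial). -/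
noncomputable def pdIter {σ : Type*} [Fintype σ] (α : σ → ℕ)
    (p : MvPolynomial σ ℚ) : MvPolynomial σ ℚ :=
  Finset.univ.toList.foldl (fun q i => (⇑(MvPolynomial.pderiv i))^[α i] q) p

/-- `b ∈ ℚ[s]` satisfies the Bernstein–Sato functional equation for the pair
`(f, g)`: there are finitely many multi-indices `α` and polynomials
`p_α ∈ (ℚ[x])[s]` with `b(m)·g·f^m = Σ_α p_α(m)·∂^α(g·f^(m+1))` for all `m ∈ ℕ`. -/
def SatisfiesBS {σ : Type*} [Fintype σ] (f g : MvPolynomial σ ℚ)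
    (b : Polynomial ℚ) : Prop :=
  ∃ (A : Finset (σ → ℕ)) (p : (σ → ℕ) → Polynomial (MvPolynomial σ ℚ)),
    ∀ m : ℕ,
      MvPolynomial.C (Polynomial.eval (m : ℚ) b) * g * f ^ m =
        ∑ α ∈ A, Polynomial.eval ((m : ℕ) : MvPolynomial σ ℚ) (p α) *
          pdIter α (g * f ^ (m + 1))

section IteratedPartial

variable {σ : Type*}

lemma coeff_iterate_pderiv [DecidableEq σ] (i : σ) (n : ℕ) (p : MvPolynomial σ ℚ) (d : σ →₀ ℕ) :
    ((⇑(pderiv i))^[n] p).coeff d =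
      p.coeff (d + Finsupp.single i n) * ((d i + n).descFactorial n : ℚ) := by
  induction n generalizing d with
  | zero => simp
  | succ n ih =>
    rw [Function.iterate_succ_apply', coeff_pderiv, ih, add_assoc, ← Finsupp.single_add,
      Nat.add_comm 1 n]
    have : (d i + (n + 1)).descFactorial (n + 1) = (d i + 1) * (d i + 1 + n).descFactorial n := by
      rw [Nat.descFactorial_succ, show d i + (n + 1) - n = d i + 1 by omega,
        show d i + (n + 1) = d i + 1 + n by omega]
    rw [this]
    simp
    ring

lemma coeff_foldl_iterate_pderiv [DecidableEq σ] (α : σ → ℕ) (l : List σ) (hl : l.Nodup)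
    (p : MvPolynomial σ ℚ) (d : σ →₀ ℕ) :
    (l.foldl (fun q i => (⇑(pderiv i))^[α i] q) p).coeff d =
      p.coeff (d + (l.map fun i => Finsupp.single i (α i)).sum) *
        (l.map fun i => ((d i + α i).descFactorial (α i) : ℚ)).prod := by
  induction l generalizing p with
  | nil => simp
  | cons a l ih =>
    have hz : (l.map fun i => Finsupp.single i (α i)).sum a = 0 := by
      have ha : a ∉ l := (List.nodup_cons.1 hl).1
      clear ih hl
      induction l with
      | nil => simp
      | cons b l ih =>
        simp only [List.mem_cons, not_or] at ha
        simp [ih ha.2, Ne.symm ha.1]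
    rw [List.foldl_cons, ih (List.nodup_cons.1 hl).2, coeff_iterate_pderiv, List.map_cons,
      List.sum_cons, List.map_cons, List.prod_cons, Finsupp.add_apply, hz, add_zero, add_assoc,
      add_comm (Finsupp.single a _), mul_assoc]

variable [Fintype σ]

lemma coeff_pdIter (α : σ → ℕ) (p : MvPolynomial σ ℚ) (d : σ →₀ ℕ) :
    (pdIter α p).coeff d = p.coeff (d + Finsupp.equivFunOnFinite.symm α) *
      ∏ i, ((d i + α i).descFactorial (α i) : ℚ) := by
  classical
  rw [pdIter, coeff_foldl_iterate_pderiv α _ (Finset.nodup_toList _), Finset.sum_map_toList,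
    Finset.prod_map_toList]
  congr 3
  ext i
  simp [Finsupp.finsetSum_apply, Finsupp.single_apply]

lemma pdIter_zero (p : MvPolynomial σ ℚ) : pdIter 0 p = p := by
  ext d
  have : (Finsupp.equivFunOnFinite.symm (0 : σ → ℕ)) = 0 := by ext; simp
  simp [coeff_pdIter, this]

lemma pderiv_pdIter [DecidableEq σ] (i : σ) (α : σ → ℕ) (p : MvPolynomial σ ℚ) :
    pderiv i (pdIter α p) = pdIter (α + Pi.single i 1) p := by
  ext d
  rw [coeff_pderiv, coeff_pdIter, coeff_pdIter, mul_assoc]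
  congr 1
  · congr 1
    ext j
    simp [Finsupp.single_apply, Pi.single_apply, eq_comm (a := j)]
    ring
  · rw [← Finset.mul_prod_erase _ _ (Finset.mem_univ i),
      ← Finset.mul_prod_erase _ _ (Finset.mem_univ i), mul_right_comm]
    congr 1
    · have : (d i + (α i + 1)).descFactorial (α i + 1) =
          (d i + 1) * (d i + 1 + α i).descFactorial (α i) := by
        rw [Nat.descFactorial_succ, show d i + (α i + 1) - α i = d i + 1 by omega,
          show d i + (α i + 1) = d i + 1 + α i by omega]
      rw [Pi.add_apply, Pi.single_eq_same, this]
      simp [mul_comm]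
    · refine Finset.prod_congr rfl fun j hj => ?_
      simp [Finset.ne_of_mem_erase hj]

end IteratedPartial

section Coefficients

/-- The exponent of the monomial `x^a y^b z^c`. -/
noncomputable def expo (a b c : ℕ) : Fin 3 →₀ ℕ := Finsupp.equivFunOnFinite.symm ![a, b, c]

lemma monomial_expo (a b c : ℕ) :
    monomial (expo a b c) (1 : ℚ) = X 0 ^ a * X 1 ^ b * X 2 ^ c := by
  rw [monomial_eq, Finsupp.prod_fintype _ _ (by simp)]
  simp [expo, Fin.prod_univ_three]

lemma expo_injective {a b c a' b' c' : ℕ} (h : expo a b c = expo a' b' c') :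
    a = a' ∧ b = b' ∧ c = c' := by
  have h0 := DFunLike.congr_fun h 0
  have h1 := DFunLike.congr_fun h 1
  have h2 := DFunLike.congr_fun h 2
  simpa [expo] using ⟨h0, h1, h2⟩

/-- The polynomial ring `ℚ[x, y, z]`. -/
abbrev QXYZ := MvPolynomial (Fin 3) ℚ

/-- The polynomial `x³z³ + y³z² + y²`. -/
noncomputable abbrev cuspSum : QXYZ :=
  (X 0) ^ 3 * (X 2) ^ 3 + (X 1) ^ 3 * (X 2) ^ 2 + (X 1) ^ 2

lemma X_mul_cuspSum_pow (n : ℕ) : X 0 * cuspSum ^ n =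
    ∑ u ∈ Finset.HasAntidiagonal.antidiagonal n, ∑ v ∈ Finset.HasAntidiagonal.antidiagonal u.1,
      monomial (expo (3 * v.1 + 1) (3 * v.2 + 2 * u.2) (3 * v.1 + 2 * v.2))
        ((n.choose u.1 * u.1.choose v.1 : ℕ) : ℚ) := by
  rw [(Commute.all _ _).add_pow', Finset.mul_sum]
  refine Finset.sum_congr rfl fun u _ => ?_
  rw [(Commute.all _ _).add_pow', Finset.sum_mul, Finset.smul_sum, Finset.mul_sum]
  refine Finset.sum_congr rfl fun v _ => ?_
  rw [← mul_one (Nat.cast _ : ℚ), ← nsmul_eq_mul, map_nsmul, monomial_expo,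
    nsmul_eq_mul, nsmul_eq_mul, nsmul_eq_mul]
  push_cast
  ring

lemma coeff_X_mul_cuspSum_pow (a b c : ℕ) :
    (X 0 * cuspSum ^ (a + b + c)).coeff (expo (3 * a + 1) (3 * b + 2 * c) (3 * a + 2 * b)) =
      ((a + b + c).factorial / (a.factorial * b.factorial * c.factorial) : ℚ) := by
  rw [X_mul_cuspSum_pow, MvPolynomial.coeff_sum, Finset.sum_eq_single (a + b, c),
    MvPolynomial.coeff_sum, Finset.sum_eq_single (a, b)]
  · simp only [MvPolynomial.coeff_monomial, if_true]
    push_cast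
    rw [Nat.cast_choose ℚ (Nat.le_add_right _ _), Nat.cast_choose ℚ (Nat.le_add_right _ _)]
    simp only [Nat.add_sub_cancel_left]
    have := Nat.cast_ne_zero (R := ℚ).2 (Nat.factorial_ne_zero (a + b))
    field_simp
  · intro v _ hv
    rw [MvPolynomial.coeff_monomial, if_neg]
    intro h
    obtain ⟨h1, h2, h3⟩ := expo_injective h
    exact hv (Prod.ext (by simp; omega) (by simp; omega))
  · simp
  · intro u _ hu
    rw [MvPolynomial.coeff_sum]
    refine Finset.sum_eq_zero fun v hv => ?_
    rw [MvPolynomial.coeff_monomial, if_neg]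
    intro h
    obtain ⟨h1, h2, h3⟩ := expo_injective h
    have := Finset.HasAntidiagonal.mem_antidiagonal.1 hv
    exact hu (Prod.ext (by simp; omega) (by simp; omega))
  · simp

lemma exists_of_coeff_X_mul_cuspSum_pow_ne_zero {n : ℕ} {e : Fin 3 →₀ ℕ}
    (h : (X 0 * cuspSum ^ n).coeff e ≠ 0) :
    ∃ a b c, a + b + c = n ∧ e = expo (3 * a + 1) (3 * b + 2 * c) (3 * a + 2 * b) := by
  rw [X_mul_cuspSum_pow, MvPolynomial.coeff_sum] at h
  obtain ⟨u, hu, h⟩ := Finset.exists_ne_zero_of_sum_ne_zero h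
  rw [MvPolynomial.coeff_sum] at h
  obtain ⟨v, hv, h⟩ := Finset.exists_ne_zero_of_sum_ne_zero h
  rw [MvPolynomial.coeff_monomial] at h
  have hu := Finset.HasAntidiagonal.mem_antidiagonal.1 hu
  have hv := Finset.HasAntidiagonal.mem_antidiagonal.1 hv
  exact ⟨v.1, v.2, u.2, by omega, (ite_ne_right_iff.1 h).1.symm⟩

end Coefficients

section GeneratedFamilies

variable {σ : Type*} [Fintype σ]

/-- The family `G` of polynomials indexed by `m : ℕ` lies in the `D[s]`-module generated by the
family `h`. -/
def InGenerated (h G : ℕ → MvPolynomial σ ℚ) : Prop :=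
  ∃ c : (σ → ℕ) →₀ Polynomial (MvPolynomial σ ℚ), ∀ m : ℕ,
    G m = c.sum fun α p => p.eval (m : MvPolynomial σ ℚ) * pdIter α (h m)

variable {h G G' : ℕ → MvPolynomial σ ℚ}

lemma InGenerated.self : InGenerated h h :=
  ⟨Finsupp.single 0 1, fun m => by simp [Finsupp.sum_single_index, pdIter_zero]⟩

lemma InGenerated.add (hG : InGenerated h G) (hG' : InGenerated h G') :
    InGenerated h (fun m => G m + G' m) := by
  classical
  obtain ⟨c, hc⟩ := hG
  obtain ⟨c', hc'⟩ := hG'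
  refine ⟨c + c', fun m => ?_⟩
  rw [Finsupp.sum_add_index' (by simp) (by simp [add_mul]), ← hc, ← hc']

lemma InGenerated.mul_eval (hG : InGenerated h G) (q : Polynomial (MvPolynomial σ ℚ)) :
    InGenerated h (fun m => q.eval (m : MvPolynomial σ ℚ) * G m) := by
  obtain ⟨c, hc⟩ := hG
  refine ⟨c.mapRange (q * ·) (mul_zero q), fun m => ?_⟩
  beta_reduce
  rw [Finsupp.sum_mapRange_index (by simp), hc, Finsupp.mul_sum]
  simp [mul_assoc]

lemma InGenerated.pderiv (hG : InGenerated h G) (i : σ) :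
    InGenerated h (fun m => MvPolynomial.pderiv i (G m)) := by
  classical
  obtain ⟨c, hc⟩ := hG
  suffices H : InGenerated h (fun m => MvPolynomial.pderiv i
      (c.sum fun α p => p.eval (m : MvPolynomial σ ℚ) * pdIter α (h m))) by
    simpa only [hc] using H
  clear hc
  induction c using Finsupp.induction_linear with
  | zero => exact ⟨0, fun m => by simp⟩
  | add c c' hc hc' =>
    convert hc.add hc' using 2 with m
    rw [← map_add, Finsupp.sum_add_index' (by simp) (by simp [add_mul])]
  | single α p =>
    have hp (m : ℕ) : MvPolynomial.pderiv i (p.eval (m : MvPolynomial σ ℚ)) =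
        (p.sum fun n a => Polynomial.monomial n (MvPolynomial.pderiv i a)).eval
          (m : MvPolynomial σ ℚ) := by
      have hm (n : ℕ) : MvPolynomial.pderiv i ((m : MvPolynomial σ ℚ) ^ n) = 0 := by
        rw [← Nat.cast_pow, Derivation.map_natCast]
      rw [Polynomial.eval_eq_sum, Polynomial.sum, Polynomial.sum, map_sum,
        Polynomial.eval_finsetSum]
      exact Finset.sum_congr rfl fun n _ => by simp [hm, mul_comm]
    refine ⟨Finsupp.single α (p.sum fun n a => Polynomial.monomial n (MvPolynomial.pderiv i a)) +
      Finsupp.single (α + Pi.single i 1) p, fun m => ?_⟩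
    beta_reduce
    rw [Finsupp.sum_add_index' (by simp) (by simp [add_mul]), Finsupp.sum_single_index (by simp),
      Finsupp.sum_single_index (by simp), Finsupp.sum_single_index (by simp), Derivation.leibniz,
      pderiv_pdIter, hp, smul_eq_mul, smul_eq_mul]
    ring

lemma satisfiesBS_of_inGenerated {f g : MvPolynomial σ ℚ} {b : Polynomial ℚ}
    (hb : InGenerated (fun m => g * f ^ (m + 1))
      (fun m => MvPolynomial.C (b.eval (m : ℚ)) * g * f ^ m)) : SatisfiesBS f g b := by
  obtain ⟨c, hc⟩ := hb
  exact ⟨c.support, c, hc⟩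

end GeneratedFamilies

section UpperBound

/-- The family `P(m) f^m` lies in the `D[s]`-module generated by `x f^(m+1)`. -/
def IsNumerator (P : ℕ → QXYZ) : Prop :=
  InGenerated (fun m => X 0 * cuspSum ^ (m + 1)) (fun m => P m * cuspSum ^ m)

variable {P P' Q κ : ℕ → QXYZ}

lemma cuspSum_ne_zero : cuspSum ≠ 0 := by
  intro h
  have := congrArg (MvPolynomial.eval ![0, 1, 0]) h
  simp [cuspSum] at this

lemma pderiv_mul_cuspSum_pow (i : Fin 3) (p : QXYZ) (m : ℕ) :
    pderiv i (p * cuspSum ^ m) * cuspSum =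
      (pderiv i p * cuspSum + (m : QXYZ) * p * pderiv i cuspSum) *
        cuspSum ^ m := by
  rw [Derivation.leibniz, Derivation.leibniz_pow, smul_eq_mul, smul_eq_mul, nsmul_eq_mul,
    smul_eq_mul]
  rcases m with _ | m
  · simp [mul_comm]
  · rw [Nat.add_sub_cancel, pow_succ]
    ring

lemma IsNumerator.combine (hP : IsNumerator P) (hP' : IsNumerator P')
    (q q' : Polynomial (QXYZ))
    (h : ∀ m, Q m = q.eval (m : QXYZ) * P m +
      q'.eval (m : QXYZ) * P' m) : IsNumerator Q := by
  have := (hP.mul_eval q).add (hP'.mul_eval q')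
  unfold IsNumerator
  convert this using 2 with m
  rw [h]
  ring

lemma IsNumerator.mul (hP : IsNumerator P) (q : Polynomial (QXYZ))
    (h : ∀ m, Q m = q.eval (m : QXYZ) * P m) : IsNumerator Q :=
  hP.combine hP q 0 fun m => by simp [h]

lemma IsNumerator.pderiv_add_pderiv (hP : IsNumerator P) (hP' : IsNumerator P') (i j : Fin 3)
    (h : ∀ m : ℕ, pderiv i (P m) * cuspSum + (m : QXYZ) * P m * pderiv i cuspSum +
      (pderiv j (P' m) * cuspSum + (m : QXYZ) * P' m * pderiv j cuspSum) =
        Q m * cuspSum) : IsNumerator Q := by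
  have := (hP.pderiv i).add (hP'.pderiv j)
  unfold IsNumerator
  convert this using 2 with m
  apply mul_right_cancel₀ cuspSum_ne_zero
  rw [add_mul, pderiv_mul_cuspSum_pow, pderiv_mul_cuspSum_pow, ← add_mul, h]
  ring

lemma pderiv_zero_cuspSum : pderiv 0 cuspSum = 3 * X 0 ^ 2 * X 2 ^ 3 := by
  simp [cuspSum, pderiv_X]
  ring

lemma pderiv_one_cuspSum : pderiv 1 cuspSum = X 1 * (2 + 3 * X 1 * X 2 ^ 2) := by
  simp [cuspSum, pderiv_X]
  ring

lemma pderiv_two_cuspSum : pderiv 2 cuspSum = 3 * X 0 ^ 3 * X 2 ^ 2 + 2 * X 1 ^ 3 * X 2 := by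
  simp [cuspSum, pderiv_X]
  ring

lemma pderiv_ofNat (i : Fin 3) (n : ℕ) [n.AtLeastTwo] :
    pderiv i (ofNat(n) : QXYZ) = 0 :=
  Derivation.map_natCast _ n

lemma IsNumerator.lower_x (hκ : ∀ i m, pderiv i (κ m) = 0) {p q : ℕ}
    (hy : IsNumerator fun m : ℕ => κ m * (X 0 * X 1 * (2 + 3 * X 1 * X 2 ^ 2)))
    (h : IsNumerator fun m : ℕ => κ m * ((2 + 3 * X 1 * X 2 ^ 2) * X 0 ^ (p + 2) * X 2 ^ q)) :
    IsNumerator fun m : ℕ => κ m * (6 * (m : QXYZ) + 2 * (p : QXYZ) + 7) *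
      ((2 + 3 * X 1 * X 2 ^ 2) * X 0 ^ (p + 1) * X 2 ^ q) := by
  set v : QXYZ := 2 + 3 * X 1 * X 2 ^ 2 with hv
  have h₁ : IsNumerator fun m : ℕ => κ m * (2 * v ^ 3 * X 0 ^ (p + 2) * X 2 ^ q) :=
    h.mul (Polynomial.C (2 * v ^ 2)) fun m => by rw [Polynomial.eval_C]; ring
  have h₂ : IsNumerator fun m : ℕ => κ m *
      (6 * X 1 * (1 + X 1 * X 2 ^ 2) * v ^ 2 * X 0 ^ (p + 1) * X 2 ^ q) :=
    hy.mul (Polynomial.C (6 * (1 + X 1 * X 2 ^ 2) * v * X 0 ^ p * X 2 ^ q)) fun m => by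
      rw [Polynomial.eval_C]; ring
  have h₃ : IsNumerator fun m : ℕ => κ m * X 0 ^ (p + 1) * X 2 ^ q *
      (2 * ((p : QXYZ) + 2) * v ^ 3 + 6 * (1 + X 1 * X 2 ^ 2) * v ^ 2 +
        6 * X 1 * X 2 ^ 2 * v * (v + 6 * (1 + X 1 * X 2 ^ 2)) + 6 * (m : QXYZ) * v ^ 3) := by
    refine h₁.pderiv_add_pderiv h₂ 0 1 fun m => ?_
    rw [pderiv_zero_cuspSum, pderiv_one_cuspSum]
    simp only [hv, cuspSum, Derivation.leibniz, Derivation.leibniz_pow, hκ, pderiv_X, map_add,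
      pderiv_ofNat, Derivation.map_one_eq_zero, smul_eq_mul,
      nsmul_eq_mul, Pi.single_apply, Fin.reduceEq, if_true, if_false]
    push_cast
    ring
  refine h₃.combine hy (Polynomial.C (MvPolynomial.C (1 / 4)))
    (Polynomial.C (MvPolynomial.C (-1 / 4) * X 0 ^ p * X 2 ^ q * X 2 ^ 2 *
      6 * (((p : QXYZ) + 2) * (v + 2) + (v + 3) + (v + 6 * (1 + X 1 * X 2 ^ 2)))) +
    Polynomial.X * Polynomial.C (MvPolynomial.C (-1 / 4) * X 0 ^ p * X 2 ^ q *
      X 2 ^ 2 * 18 * (v + 2))) fun m => ?_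
  have h4 : (MvPolynomial.C (1 / 4) : QXYZ) * 4 = 1 := by
    rw [← map_ofNat MvPolynomial.C 4, ← map_mul]; norm_num
  have h4' : (MvPolynomial.C (-1 / 4) : QXYZ) = - MvPolynomial.C (1 / 4) := by
    rw [← map_neg]; norm_num
  simp only [Polynomial.eval_add, Polynomial.eval_mul, Polynomial.eval_C, Polynomial.eval_X, h4']
  rw [hv]
  linear_combination (-(κ m * (6 * (m : QXYZ) + 2 * (p : QXYZ) + 7) *
      ((2 + 3 * X 1 * X 2 ^ 2) * X 0 ^ (p + 1) * X 2 ^ q))) * h4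

lemma IsNumerator.lower_z (hκ : ∀ i m, pderiv i (κ m) = 0) {p q : ℕ}
    (hy : IsNumerator fun m : ℕ => κ m * (X 0 * X 1 * (2 + 3 * X 1 * X 2 ^ 2)))
    (h : IsNumerator fun m : ℕ => κ m * ((2 + 3 * X 1 * X 2 ^ 2) * X 0 ^ (p + 1) * X 2 ^ (q + 1))) :
    IsNumerator fun m : ℕ => κ m * (6 * (m : QXYZ) + 2 * (q : QXYZ) + 5) *
      ((2 + 3 * X 1 * X 2 ^ 2) * X 0 ^ (p + 1) * X 2 ^ q) := by
  set v : QXYZ := 2 + 3 * X 1 * X 2 ^ 2 with hv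
  have h₁ : IsNumerator fun m : ℕ => κ m * (2 * v ^ 3 * X 0 ^ (p + 1) * X 2 ^ (q + 1)) :=
    h.mul (Polynomial.C (2 * v ^ 2)) fun m => by rw [Polynomial.eval_C]; ring
  have h₂ : IsNumerator fun m : ℕ => κ m *
      ((6 * X 1 * (1 + X 1 * X 2 ^ 2) - 4 * X 1 ^ 2 * X 2 ^ 2) * v ^ 2 *
        X 0 ^ (p + 1) * X 2 ^ q) :=
    hy.mul (Polynomial.C ((6 * (1 + X 1 * X 2 ^ 2) - 4 * X 1 * X 2 ^ 2) * v *
      X 0 ^ p * X 2 ^ q)) fun m => by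
      rw [Polynomial.eval_C]; ring
  have h₃ : IsNumerator fun m : ℕ => κ m * X 0 ^ (p + 1) * X 2 ^ q *
      (2 * ((q : QXYZ) + 1) * v ^ 3 + 36 * v ^ 2 * X 1 * X 2 ^ 2 + 6 * (1 + X 1 * X 2 ^ 2) * v ^ 2 +
        6 * X 1 * X 2 ^ 2 * v * (v + 6 * (1 + X 1 * X 2 ^ 2)) -
        X 2 ^ 2 * X 1 * v * (8 * v + 24 * X 1 * X 2 ^ 2) + 6 * (m : QXYZ) * v ^ 3) := by
    refine h₁.pderiv_add_pderiv h₂ 2 1 fun m => ?_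
    rw [pderiv_two_cuspSum, pderiv_one_cuspSum]
    simp only [hv, cuspSum, Derivation.leibniz, Derivation.leibniz_pow, hκ, pderiv_X, map_add,
      map_sub, pderiv_ofNat, Derivation.map_one_eq_zero,
      smul_eq_mul, nsmul_eq_mul, Pi.single_apply, Fin.reduceEq, if_true, if_false]
    push_cast
    ring
  refine h₃.combine hy (Polynomial.C (MvPolynomial.C (1 / 4)))
    (Polynomial.C (MvPolynomial.C (-1 / 4) * X 0 ^ p * X 2 ^ q * X 2 ^ 2 *
      (6 * (((q : QXYZ) + 1) * (v + 2) + (v + 3) + (v + 6 * (1 + X 1 * X 2 ^ 2))) + 36 * v -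
      (8 * v + 24 * X 1 * X 2 ^ 2))) +
    Polynomial.X * Polynomial.C (MvPolynomial.C (-1 / 4) * X 0 ^ p * X 2 ^ q *
      X 2 ^ 2 * 18 * (v + 2))) fun m => ?_
  have h4 : (MvPolynomial.C (1 / 4) : QXYZ) * 4 = 1 := by
    rw [← map_ofNat MvPolynomial.C 4, ← map_mul]; norm_num
  have h4' : (MvPolynomial.C (-1 / 4) : QXYZ) = - MvPolynomial.C (1 / 4) := by
    rw [← map_neg]; norm_num
  simp only [Polynomial.eval_add, Polynomial.eval_mul, Polynomial.eval_C, Polynomial.eval_X, h4']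
  rw [hv]
  linear_combination (-(κ m * (6 * (m : QXYZ) + 2 * (q : QXYZ) + 5) *
      ((2 + 3 * X 1 * X 2 ^ 2) * X 0 ^ (p + 1) * X 2 ^ q))) * h4

lemma isNumerator_pderiv_generator (i : Fin 3) : IsNumerator fun m : ℕ =>
    pderiv i (X 0) * cuspSum + ((m : QXYZ) + 1) * X 0 * pderiv i cuspSum := by
  have := (InGenerated.self (h := fun m : ℕ => (X 0 : QXYZ) * cuspSum ^ (m + 1))).pderiv i
  unfold IsNumerator
  convert this using 2 with m
  rw [Derivation.leibniz, Derivation.leibniz_pow, smul_eq_mul, smul_eq_mul, nsmul_eq_mul,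
    smul_eq_mul, Nat.add_sub_cancel, pow_succ]
  push_cast
  ring

lemma isNumerator_x_y_unit : IsNumerator fun m : ℕ =>
    ((m : QXYZ) + 1) * (X 0 * X 1 * (2 + 3 * X 1 * X 2 ^ 2)) := by
  refine (isNumerator_pderiv_generator 1).mul 1 fun m => ?_
  rw [pderiv_one_cuspSum]
  simp [pderiv_X]
  ring

lemma isNumerator_x_pow_z_pow : IsNumerator fun m : ℕ =>
    ((m : QXYZ) + 1) * ((2 + 3 * X 1 * X 2 ^ 2) * X 0 ^ (2 + 2) * X 2 ^ (1 + 1)) := by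
  have h3 : (MvPolynomial.C (1 / 3) : QXYZ) * 3 = 1 := by
    rw [← map_ofNat MvPolynomial.C 3, ← map_mul]; norm_num
  refine (isNumerator_pderiv_generator 2).combine isNumerator_x_y_unit
    (Polynomial.C (MvPolynomial.C (1 / 3) * (2 + 3 * X 1 * X 2 ^ 2)))
    (Polynomial.C (-MvPolynomial.C (1 / 3) * 2 * X 1 ^ 2 * X 2)) fun m => ?_
  rw [pderiv_two_cuspSum, pderiv_X_of_ne (by decide), Polynomial.eval_C, Polynomial.eval_C]
  linear_combination
    (-((m : QXYZ) + 1) * ((2 + 3 * X 1 * X 2 ^ 2) * X 0 ^ 4 * X 2 ^ 2)) * h3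

lemma isNumerator_x_y_pow_z_pow : IsNumerator fun m : ℕ =>
    ((m : QXYZ) + 1) * (X 0 * X 1 ^ 3 * X 2 ^ 2) := by
  have h2 : (MvPolynomial.C (1 / 2) : QXYZ) * 2 = 1 := by
    rw [← map_ofNat MvPolynomial.C 2, ← map_mul]; norm_num
  have hf : IsNumerator fun _ => X 0 * cuspSum := by
    unfold IsNumerator
    convert InGenerated.self (h := fun m : ℕ => (X 0 : QXYZ) * cuspSum ^ (m + 1)) using 2 with m
    rw [pow_succ]
    ring
  have hx : IsNumerator fun m : ℕ => ((m : QXYZ) + 1) * X 0 * pderiv 0 cuspSum * X 0 := by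
    refine (isNumerator_pderiv_generator 0).combine hf (Polynomial.C (X 0)) (-1) fun m => ?_
    simp [pderiv_X]
    ring
  refine (isNumerator_pderiv_generator 2).combine hx
    (Polynomial.C (MvPolynomial.C (1 / 2) * X 2)) (Polynomial.C (-MvPolynomial.C (1 / 2)))
    fun m => ?_
  rw [pderiv_two_cuspSum, pderiv_zero_cuspSum, pderiv_X_of_ne (by decide), Polynomial.eval_C,
    Polynomial.eval_C]
  linear_combination (-((m : QXYZ) + 1) * (X 0 * X 1 ^ 3 * X 2 ^ 2)) * h2

lemma isNumerator_x : IsNumerator fun m : ℕ => ((m : QXYZ) + 1) *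
    ((6 * (m : QXYZ) + 7) * (6 * (m : QXYZ) + 5) * (6 * (m : QXYZ) + 11) *
      (6 * (m : QXYZ) + 9) * (6 * (m : QXYZ) + 7)) * X 0 := by
  have step (a : ℕ) {b : QXYZ} (hb : ∀ i, pderiv i b = 0) {κ : ℕ → QXYZ}
      (hκ : ∀ i m, pderiv i (κ m) = 0) (i : Fin 3) (m : ℕ) :
      pderiv i (κ m * (6 * (m : QXYZ) + 2 * (a : QXYZ) + b)) = 0 := by
    simp [Derivation.leibniz, hκ, hb, pderiv_ofNat]
  have mulY {κ : ℕ → QXYZ} (a : ℕ) (b : QXYZ)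
      (h : IsNumerator fun m : ℕ => κ m * (X 0 * X 1 * (2 + 3 * X 1 * X 2 ^ 2))) :
      IsNumerator fun m : ℕ => κ m * (6 * (m : QXYZ) + 2 * (a : QXYZ) + b) *
        (X 0 * X 1 * (2 + 3 * X 1 * X 2 ^ 2)) :=
    h.mul (6 * Polynomial.X + Polynomial.C (2 * (a : QXYZ) + b)) fun m => by
      simp
      ring
  have k₀ : ∀ (i : Fin 3) (m : ℕ), pderiv i ((m : QXYZ) + 1) = 0 := by simp
  have k₁ := step 1 (pderiv_ofNat · 5) k₀
  have k₂ := step 0 (pderiv_ofNat · 5) k₁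
  have k₃ := step 2 (pderiv_ofNat · 7) k₂
  have k₄ := step 1 (pderiv_ofNat · 7) k₃
  have y₀ := isNumerator_x_y_unit
  have y₁ := mulY 1 5 y₀
  have y₂ := mulY 0 5 y₁
  have y₃ := mulY 2 7 y₂
  have y₄ := mulY 1 7 y₃
  have h₁ := IsNumerator.lower_z (p := 3) (q := 1) k₀ y₀ isNumerator_x_pow_z_pow
  have h₂ := IsNumerator.lower_z (p := 3) (q := 0) k₁ y₁ h₁
  have h₃ := IsNumerator.lower_x (p := 2) (q := 0) k₂ y₂ h₂
  have h₄ := IsNumerator.lower_x (p := 1) (q := 0) k₃ y₃ h₃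
  have h₅ := IsNumerator.lower_x (p := 0) (q := 0) k₄ y₄ h₄
  have h8 : (MvPolynomial.C (1 / 8) : QXYZ) * 8 = 1 := by
    rw [← map_ofNat MvPolynomial.C 8, ← map_mul]; norm_num
  refine h₅.combine isNumerator_x_y_pow_z_pow
    (Polynomial.C (MvPolynomial.C (1 / 8) * ((2 + 3 * X 1 * X 2 ^ 2) ^ 2 -
      6 * (2 + 3 * X 1 * X 2 ^ 2) + 12)))
    (Polynomial.C (-27 * MvPolynomial.C (1 / 8) * X 2 ^ 4) *
      ((6 * Polynomial.X + 7) * (6 * Polynomial.X + 5) * (6 * Polynomial.X + 11) *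
        (6 * Polynomial.X + 9) * (6 * Polynomial.X + 7))) fun m => ?_
  simp only [Polynomial.eval_add, Polynomial.eval_mul, Polynomial.eval_C, Polynomial.eval_X,
    Polynomial.eval_ofNat]
  push_cast
  linear_combination (-((m : QXYZ) + 1) *
    ((6 * (m : QXYZ) + 7) * (6 * (m : QXYZ) + 5) * (6 * (m : QXYZ) + 11) *
      (6 * (m : QXYZ) + 9) * (6 * (m : QXYZ) + 7)) * X 0) * h8

lemma satisfiesBS_of_dvd {b : Polynomial ℚ}
    (hb : (Polynomial.X + Polynomial.C (5 / 6 : ℚ)) *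
      (Polynomial.X + Polynomial.C (1 : ℚ)) *
      (Polynomial.X + Polynomial.C (7 / 6 : ℚ)) ^ 2 *
      (Polynomial.X + Polynomial.C (3 / 2 : ℚ)) *
      (Polynomial.X + Polynomial.C (11 / 6 : ℚ)) ∣ b) : SatisfiesBS cuspSum (X 0) b := by
  obtain ⟨q, rfl⟩ := hb
  refine satisfiesBS_of_inGenerated (isNumerator_x.mul
    ((q * Polynomial.C (1 / 7776)).map MvPolynomial.C) fun m => ?_)
  have hm : (m : QXYZ) = MvPolynomial.C (m : ℚ) := (map_natCast _ m).symm
  rw [hm, Polynomial.eval_map, Polynomial.eval₂_at_apply]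
  simp only [← map_ofNat (MvPolynomial.C (σ := Fin 3) (R := ℚ)), ← map_mul, ← map_add,
    ← map_one (MvPolynomial.C (σ := Fin 3) (R := ℚ)), ← mul_assoc]
  congr 2
  simp only [Polynomial.eval_add, Polynomial.eval_mul, Polynomial.eval_C, Polynomial.eval_X,
    Polynomial.eval_pow]
  ring

end UpperBound

section LowerBound

open Filter

lemma descFactorial_add_right (n b c : ℕ) :
    (n + b).descFactorial (b + c) = (n + b).descFactorial b * n.descFactorial c := by
  have := Nat.descFactorial_mul_descFactorial (n := n + b) (Nat.le_add_right b c)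
  rw [Nat.add_sub_cancel, Nat.add_sub_cancel_left] at this
  rw [← this, mul_comm]

lemma descFactorial_three_mul (i a : ℕ) :
    (3 * i + 3 * a).descFactorial (3 * a) * i.factorial =
      (i + a).factorial * ∏ t ∈ Finset.range a, 3 * (3 * i + 3 * t + 1) * (3 * i + 3 * t + 2) := by
  induction a with
  | zero => simp
  | succ a ih =>
    rw [Finset.prod_range_succ, ← add_assoc i a 1, Nat.factorial_succ,
      show 3 * i + 3 * (a + 1) = 3 * i + 3 * a + 3 by ring, show 3 * (a + 1) = 3 + 3 * a by ring,
      descFactorial_add_right, mul_assoc, ih]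
    simp only [Nat.descFactorial_succ, Nat.descFactorial_zero, Nat.sub_zero, mul_one,
      show 3 * i + 3 * a + 3 - 2 = 3 * i + 3 * a + 1 by omega,
      show 3 * i + 3 * a + 3 - 1 = 3 * i + 3 * a + 2 by omega]
    ring

lemma descFactorial_two_mul (k a : ℕ) :
    (2 * k + 2 * a).descFactorial (2 * a) * k.factorial =
      (k + a).factorial * ∏ t ∈ Finset.range a, 2 * (2 * k + 2 * t + 1) := by
  induction a with
  | zero => simp
  | succ a ih =>
    rw [Finset.prod_range_succ, ← add_assoc k a 1, Nat.factorial_succ,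
      show 2 * k + 2 * (a + 1) = 2 * k + 2 * a + 2 by ring, show 2 * (a + 1) = 2 + 2 * a by ring,
      descFactorial_add_right, mul_assoc, ih]
    simp only [Nat.descFactorial_succ, Nat.descFactorial_zero, Nat.sub_zero, mul_one,
      show 2 * k + 2 * a + 2 - 1 = 2 * k + 2 * a + 1 by omega]
    ring

lemma eval_aeval {σ : Type*} (v : σ → ℚ) (r : MvPolynomial σ ℚ) (q : Polynomial ℚ) :
    MvPolynomial.eval v (Polynomial.aeval r q) = q.eval (MvPolynomial.eval v r) := by
  rw [Polynomial.aeval_def, Polynomial.hom_eval₂, Polynomial.eval]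
  congr 1
  ext x
  simp

/-- The polynomial `r (r - 1) ⋯ (r - n + 1)` for a polynomial `r` in two variables. -/
noncomputable def fallingPow (r : MvPolynomial (Fin 2) ℚ) (n : ℕ) : MvPolynomial (Fin 2) ℚ :=
  Polynomial.aeval r (descPochhammer ℚ n)

lemma eval_fallingPow {r : MvPolynomial (Fin 2) ℚ} {v : Fin 2 → ℚ} {a : ℕ}
    (h : MvPolynomial.eval v r = a) (n : ℕ) :
    MvPolynomial.eval v (fallingPow r n) = a.descFactorial n := by
  rw [← descPochhammer_eval_eq_descFactorial, ← h, fallingPow, eval_aeval]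

/-- For large `i` and `k`, the function `F` is a polynomial in `i` and `k` lying in the ideal
`(i + k + 1) (2k + 1, (3i + 1)(3i + 2)²(3i + 3)(3i + 4))`. -/
def EventuallyInIdeal (F : ℕ × ℕ → ℚ) : Prop :=
  ∃ U V : MvPolynomial (Fin 2) ℚ, ∀ᶠ p : ℕ × ℕ in atTop, F p = (p.1 + p.2 + 1) *
    ((2 * p.2 + 1) * MvPolynomial.eval ![(p.1 : ℚ), (p.2 : ℚ)] U +
      (3 * p.1 + 1) * (3 * p.1 + 2) ^ 2 * (3 * p.1 + 3) * (3 * p.1 + 4) *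
        MvPolynomial.eval ![(p.1 : ℚ), (p.2 : ℚ)] V)

variable {F F' : ℕ × ℕ → ℚ}

lemma EventuallyInIdeal.congr (hF : EventuallyInIdeal F) (h : ∀ p, F' p = F p) :
    EventuallyInIdeal F' := by
  rwa [funext h]

lemma EventuallyInIdeal.of_eventually_zero (hF : ∀ᶠ p in atTop, F p = 0) :
    EventuallyInIdeal F :=
  ⟨0, 0, hF.mono fun p hp => by simp [hp]⟩

lemma EventuallyInIdeal.add (hF : EventuallyInIdeal F) (hF' : EventuallyInIdeal F') :
    EventuallyInIdeal (fun p => F p + F' p) := by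
  obtain ⟨U, V, h⟩ := hF
  obtain ⟨U', V', h'⟩ := hF'
  refine ⟨U + U', V + V', ?_⟩
  filter_upwards [h, h'] with p hp hp'
  rw [hp, hp', map_add, map_add]
  ring

lemma EventuallyInIdeal.sum {ι : Type*} {s : Finset ι} {F : ι → ℕ × ℕ → ℚ}
    (hF : ∀ j ∈ s, EventuallyInIdeal (F j)) : EventuallyInIdeal (fun p => ∑ j ∈ s, F j p) := by
  classical
  induction s using Finset.induction_on with
  | empty => exact .of_eventually_zero (by simp)
  | insert j s hj ih =>
    simp only [Finset.sum_insert hj]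
    exact (hF j (Finset.mem_insert_self j s)).add
      (ih fun l hl => hF l (Finset.mem_insert_of_mem hl))

lemma EventuallyInIdeal.mul_eval (hF : EventuallyInIdeal F) (q : MvPolynomial (Fin 2) ℚ) :
    EventuallyInIdeal (fun p => MvPolynomial.eval ![(p.1 : ℚ), (p.2 : ℚ)] q * F p) := by
  obtain ⟨U, V, h⟩ := hF
  refine ⟨q * U, q * V, ?_⟩
  filter_upwards [h] with p hp
  rw [hp, map_mul, map_mul]
  ring

/-- The coefficient of `x^(3i+1) y^(2k) z^(3i)`, normalised so that the one of `x f^(i+k)`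
is `1`. -/
noncomputable def normCoeff (i k : ℕ) (G : QXYZ) : ℚ :=
  i.factorial * k.factorial / (i + k).factorial * G.coeff (expo (3 * i + 1) (2 * k) (3 * i))

lemma normCoeff_add (i k : ℕ) (G H : QXYZ) :
    normCoeff i k (G + H) = normCoeff i k G + normCoeff i k H := by
  rw [normCoeff, MvPolynomial.coeff_add, mul_add, normCoeff, normCoeff]

lemma normCoeff_C_mul (i k : ℕ) (r : ℚ) (G : QXYZ) :
    normCoeff i k (MvPolynomial.C r * G) = r * normCoeff i k G := by
  rw [normCoeff, MvPolynomial.coeff_C_mul, normCoeff]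
  ring

lemma normCoeff_sum {ι : Type*} (s : Finset ι) (i k : ℕ) (G : ι → QXYZ) :
    normCoeff i k (∑ j ∈ s, G j) = ∑ j ∈ s, normCoeff i k (G j) := by
  simp only [normCoeff, MvPolynomial.coeff_sum, Finset.mul_sum]

lemma normCoeff_X_mul_cuspSum_pow (i k : ℕ) : normCoeff i k (X 0 * cuspSum ^ (i + k)) = 1 := by
  have := coeff_X_mul_cuspSum_pow i 0 k
  rw [add_zero, mul_zero, mul_zero, zero_add, add_zero] at this
  rw [normCoeff, this]
  have h₁ := Nat.cast_ne_zero (R := ℚ).2 (Nat.factorial_ne_zero i)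
  have h₂ := Nat.cast_ne_zero (R := ℚ).2 (Nat.factorial_ne_zero k)
  have h₃ := Nat.cast_ne_zero (R := ℚ).2 (Nat.factorial_ne_zero (i + k))
  simp
  field_simp

lemma normCoeff_monomial_mul_pdIter {i k a b c : ℕ} {α β : Fin 3 → ℕ} (habc : a + b + c = i + k + 1)
    (h₀ : β 0 ≤ 3 * i + 1) (h₁ : β 1 ≤ 2 * k) (h₂ : β 2 ≤ 3 * i)
    (h₀' : 3 * i + 1 - β 0 + α 0 = 3 * a + 1) (h₁' : 2 * k - β 1 + α 1 = 3 * b + 2 * c)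
    (h₂' : 3 * i - β 2 + α 2 = 3 * a + 2 * b) :
    normCoeff i k (monomial (Finsupp.equivFunOnFinite.symm β) 1 *
        pdIter α (X 0 * cuspSum ^ (i + k + 1))) =
      i.factorial * k.factorial / (i + k).factorial *
        ((i + k + 1).factorial / (a.factorial * b.factorial * c.factorial)) *
        ((3 * a + 1).descFactorial (α 0) * (3 * b + 2 * c).descFactorial (α 1) *
          (3 * a + 2 * b).descFactorial (α 2)) := by
  have hle : Finsupp.equivFunOnFinite.symm β ≤ expo (3 * i + 1) (2 * k) (3 * i) := by
    intro j
    fin_cases j <;> simpa [expo]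
  have he : expo (3 * i + 1) (2 * k) (3 * i) - Finsupp.equivFunOnFinite.symm β +
      Finsupp.equivFunOnFinite.symm α = expo (3 * a + 1) (3 * b + 2 * c) (3 * a + 2 * b) := by
    ext j
    fin_cases j <;> simpa [expo]
  rw [normCoeff, MvPolynomial.coeff_monomial_mul', if_pos hle, one_mul, coeff_pdIter, he,
    ← habc, coeff_X_mul_cuspSum_pow, Fin.prod_univ_three, ← h₀', ← h₁', ← h₂']
  simp [expo]
  ring

lemma exists_of_normCoeff_monomial_mul_pdIter_ne_zero {i k : ℕ} {α β : Fin 3 → ℕ}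
    (h : normCoeff i k (monomial (Finsupp.equivFunOnFinite.symm β) 1 *
      pdIter α (X 0 * cuspSum ^ (i + k + 1))) ≠ 0) :
    ∃ a b c, a + b + c = i + k + 1 ∧ β 0 ≤ 3 * i + 1 ∧ β 1 ≤ 2 * k ∧ β 2 ≤ 3 * i ∧
      3 * i + 1 - β 0 + α 0 = 3 * a + 1 ∧ 2 * k - β 1 + α 1 = 3 * b + 2 * c ∧
      3 * i - β 2 + α 2 = 3 * a + 2 * b := by
  rw [normCoeff, MvPolynomial.coeff_monomial_mul'] at h
  obtain ⟨hle, h⟩ := ite_ne_right_iff.1 (right_ne_zero_of_mul h)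
  rw [one_mul, coeff_pdIter] at h
  obtain ⟨a, b, c, habc, he⟩ :=
    exists_of_coeff_X_mul_cuspSum_pow_ne_zero (left_ne_zero_of_mul h)
  exact ⟨a, b, c, habc, hle 0, hle 1, hle 2, DFunLike.congr_fun he 0, DFunLike.congr_fun he 1,
    DFunLike.congr_fun he 2⟩

lemma eventuallyInIdeal_of_gt {α β : Fin 3 → ℕ} {a b : ℕ} (h₀ : α 0 = 3 * (a + 1) + β 0)
    (h₁ : α 1 + 2 * a = b + β 1) (h₂ : α 2 = 3 * (a + 1) + 2 * b + β 2) :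
    EventuallyInIdeal fun p => normCoeff p.1 p.2 (monomial (Finsupp.equivFunOnFinite.symm β) 1 *
      pdIter α (X 0 * cuspSum ^ (p.1 + p.2 + 1))) := by
  refine ⟨0, MvPolynomial.C (1 / b.factorial : ℚ) * fallingPow (X 1) (a + b) * 3 *
    (∏ t ∈ Finset.range a, 3 * (3 * X 0 + 3 * MvPolynomial.C (t : ℚ) + 4) *
      (3 * X 0 + 3 * MvPolynomial.C (t : ℚ) + 5)) *
    fallingPow (3 * X 0 + MvPolynomial.C (3 * a + 4 : ℚ)) (3 * a) * fallingPow (3 * X 0 + 1) (β 0) *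
    fallingPow (3 * X 0 + MvPolynomial.C (3 * a + 3 + 2 * b : ℚ)) (2 * b) *
    fallingPow (3 * X 0) (β 2) *
    fallingPow (2 * X 1 + MvPolynomial.C (b - 2 * a : ℚ)) (α 1), ?_⟩
  filter_upwards [eventually_ge_atTop (β 0 + β 2, β 1 + 2 * a + b)] with ⟨i, k⟩ ⟨hi, hk⟩
  simp only at hi hk
  obtain ⟨c, rfl⟩ : ∃ c, k = a + b + c := ⟨k - (a + b), by omega⟩
  rw [normCoeff_monomial_mul_pdIter (a := i + (a + 1)) (b := b) (c := c) (by omega) (by omega)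
    (by omega) (by omega) (by omega) (by omega) (by omega)]
  have hk₀ : (a + b + c).factorial = c.factorial * (a + b + c).descFactorial (a + b) := by
    rw [← Nat.factorial_mul_descFactorial (Nat.le_add_right (a + b) c), Nat.add_sub_cancel_left]
  have e₀ : (3 * (i + (a + 1)) + 1).descFactorial (α 0) =
      (3 * i + (3 * a + 4)).descFactorial (3 * a) * ((3 * i + 4) * (3 * i + 3) * (3 * i + 2)) *
        (3 * i + 1).descFactorial (β 0) := by
    rw [h₀, show 3 * (i + (a + 1)) + 1 = (3 * i + 1 + 3) + 3 * a by ring,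
      show 3 * (a + 1) + β 0 = 3 * a + (3 + β 0) by ring, descFactorial_add_right,
      descFactorial_add_right, show 3 * i + 1 + 3 + 3 * a = 3 * i + (3 * a + 4) by ring]
    simp only [Nat.descFactorial_succ, Nat.descFactorial_zero, Nat.sub_zero, mul_one,
      Nat.reduceSubDiff]
    ring
  have e₂ : (3 * (i + (a + 1)) + 2 * b).descFactorial (α 2) * i.factorial =
      (3 * i + (3 * a + 3 + 2 * b)).descFactorial (2 * b) * (3 * i).descFactorial (β 2) *
      ((i + (a + 1)).factorial *
        ((∏ t ∈ Finset.range a, 3 * (3 * i + 3 * t + 4) * (3 * i + 3 * t + 5)) *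
          (3 * (3 * i + 1) * (3 * i + 2)))) := by
    have hp : (∏ t ∈ Finset.range a, 3 * (3 * i + 3 * t + 4) * (3 * i + 3 * t + 5)) *
        (3 * (3 * i + 1) * (3 * i + 2)) =
        ∏ t ∈ Finset.range (a + 1), 3 * (3 * i + 3 * t + 1) * (3 * i + 3 * t + 2) := by
      rw [Finset.prod_range_succ']
      rfl
    rw [hp, ← descFactorial_three_mul, h₂, show 3 * (i + (a + 1)) = 3 * i + 3 * (a + 1) by ring,
      show 3 * (a + 1) + 2 * b + β 2 = 2 * b + (3 * (a + 1) + β 2) by ring,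
      descFactorial_add_right, descFactorial_add_right,
      show 3 * i + (3 * a + 3 + 2 * b) = 3 * i + 3 * (a + 1) + 2 * b by ring]
    ring
  have e₂' := congrArg (Nat.cast (R := ℚ)) e₂
  push_cast at e₂'
  rw [e₀, Nat.factorial_succ (i + (a + b + c)), hk₀]
  simp only [map_mul, map_prod, map_add, map_zero, MvPolynomial.eval_C, MvPolynomial.eval_X,
    map_ofNat, Matrix.cons_val_zero]
  rw [eval_fallingPow (a := a + b + c) (by simp),
    eval_fallingPow (a := 3 * i + (3 * a + 4)) (by simp),
    eval_fallingPow (a := 3 * i + 1) (by simp),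
    eval_fallingPow (a := 3 * i + (3 * a + 3 + 2 * b)) (by simp),
    eval_fallingPow (a := 3 * i) (by simp),
    eval_fallingPow (a := 3 * b + 2 * c) (by simp; ring)]
  have f₁ := Nat.cast_ne_zero (R := ℚ).2 (Nat.factorial_ne_zero b)
  have f₂ := Nat.cast_ne_zero (R := ℚ).2 (Nat.factorial_ne_zero c)
  have f₃ := Nat.cast_ne_zero (R := ℚ).2 (Nat.factorial_ne_zero (i + (a + b + c)))
  have f₄ := Nat.cast_ne_zero (R := ℚ).2 (Nat.factorial_ne_zero (i + (a + 1)))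
  push_cast
  generalize (∏ t ∈ Finset.range a, _ : ℚ) = π at *
  field_simp
  linear_combination (((a + b + c).descFactorial (a + b) : ℚ) *
    (3 * i + (3 * a + 4)).descFactorial (3 * a) * 3 * (3 * i + 4) * (i + 1) * (3 * i + 2) *
    (3 * i + 1).descFactorial (β 0) * (3 * b + 2 * c).descFactorial (α 1)) * e₂'

lemma eventuallyInIdeal_of_le {α β : Fin 3 → ℕ} {a b : ℕ} (h₀ : α 0 + 3 * a = β 0)
    (h₁ : α 1 = b + 2 * (a + 1) + β 1) (h₂ : α 2 + 3 * a = 2 * b + β 2) :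
    EventuallyInIdeal fun p => normCoeff p.1 p.2 (monomial (Finsupp.equivFunOnFinite.symm β) 1 *
      pdIter α (X 0 * cuspSum ^ (p.1 + p.2 + 1))) := by
  refine ⟨MvPolynomial.C (1 / b.factorial : ℚ) * fallingPow (X 0) a * 2 *
    (∏ t ∈ Finset.range a, 2 * (2 * X 1 + 2 * MvPolynomial.C (t : ℚ) + 3)) *
    fallingPow (X 1 + MvPolynomial.C (a + 1 : ℚ)) b *
    fallingPow (2 * X 1 + MvPolynomial.C (2 * a + 2 + b : ℚ)) b * fallingPow (2 * X 1) (β 1) *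
    fallingPow (3 * X 0 + MvPolynomial.C (1 - 3 * a : ℚ)) (α 0) *
    fallingPow (3 * X 0 + MvPolynomial.C (2 * b - 3 * a : ℚ)) (α 2), 0, ?_⟩
  filter_upwards [eventually_ge_atTop (β 0 + β 2 + a, β 1 + b)] with ⟨i, k⟩ ⟨hi, hk⟩
  simp only at hi hk
  obtain ⟨i, rfl⟩ : ∃ j, i = a + j := ⟨i - a, by omega⟩
  obtain ⟨c, hc⟩ : ∃ c, k + a + 1 = b + c := ⟨k + a + 1 - b, by omega⟩
  rw [normCoeff_monomial_mul_pdIter (a := i) (b := b) (c := c) (by omega) (by omega)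
    (by omega) (by omega) (by omega) (by omega) (by omega)]
  have hi₀ : (a + i).factorial = i.factorial * (a + i).descFactorial a := by
    rw [← Nat.factorial_mul_descFactorial (Nat.le_add_right a i), Nat.add_sub_cancel_left]
  have hc₀ : (k + (a + 1)).factorial = c.factorial * (k + (a + 1)).descFactorial b := by
    rw [← Nat.factorial_mul_descFactorial (show b ≤ k + (a + 1) by omega),
      show k + (a + 1) - b = c by omega]
  have e₁ : (3 * b + 2 * c).descFactorial (α 1) * k.factorial =
      (2 * k + (2 * a + 2 + b)).descFactorial b * (2 * k).descFactorial (β 1) *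
      (c.factorial * (k + (a + 1)).descFactorial b *
        ((∏ t ∈ Finset.range a, 2 * (2 * k + 2 * t + 3)) * (2 * (2 * k + 1)))) := by
    have hp : (∏ t ∈ Finset.range a, 2 * (2 * k + 2 * t + 3)) * (2 * (2 * k + 1)) =
        ∏ t ∈ Finset.range (a + 1), 2 * (2 * k + 2 * t + 1) := by
      rw [Finset.prod_range_succ']
      rfl
    rw [hp, ← hc₀, ← descFactorial_two_mul, h₁,
      show 3 * b + 2 * c = 2 * k + 2 * (a + 1) + b by omega,
      add_assoc b, descFactorial_add_right, descFactorial_add_right,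
      show 2 * k + (2 * a + 2 + b) = 2 * k + 2 * (a + 1) + b by ring]
    ring
  have e₁' := congrArg (Nat.cast (R := ℚ)) e₁
  push_cast at e₁'
  rw [Nat.factorial_succ (a + i + k), hi₀]
  simp only [map_mul, map_prod, map_add, map_zero, MvPolynomial.eval_C, MvPolynomial.eval_X,
    map_ofNat, Matrix.cons_val_zero, Matrix.cons_val_one]
  rw [eval_fallingPow (a := a + i) (by simp),
    eval_fallingPow (a := k + (a + 1)) (by simp),
    eval_fallingPow (a := 2 * k + (2 * a + 2 + b)) (by simp),
    eval_fallingPow (a := 2 * k) (by simp),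
    eval_fallingPow (a := 3 * i + 1) (by simp; ring),
    eval_fallingPow (a := 3 * i + 2 * b) (by simp; ring)]
  have f₁ := Nat.cast_ne_zero (R := ℚ).2 (Nat.factorial_ne_zero b)
  have f₂ := Nat.cast_ne_zero (R := ℚ).2 (Nat.factorial_ne_zero c)
  have f₃ := Nat.cast_ne_zero (R := ℚ).2 (Nat.factorial_ne_zero (a + i + k))
  have f₄ := Nat.cast_ne_zero (R := ℚ).2 (Nat.factorial_ne_zero i)
  push_cast
  generalize (∏ t ∈ Finset.range a, _ : ℚ) = π at *
  field_simp
  linear_combination (((a + i).descFactorial a : ℚ) * (3 * i + 1).descFactorial (α 0) *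
    (3 * i + 2 * b).descFactorial (α 2)) * e₁'

lemma eventuallyInIdeal_monomial_mul_pdIter (α β : Fin 3 → ℕ) :
    EventuallyInIdeal fun p => normCoeff p.1 p.2 (monomial (Finsupp.equivFunOnFinite.symm β) 1 *
      pdIter α (X 0 * cuspSum ^ (p.1 + p.2 + 1))) := by
  by_cases h : ∃ i k, normCoeff i k (monomial (Finsupp.equivFunOnFinite.symm β) 1 *
      pdIter α (X 0 * cuspSum ^ (i + k + 1))) ≠ 0
  · obtain ⟨i, k, h⟩ := h
    obtain ⟨a, b, c, habc, _, _, _, h₀, h₁, h₂⟩ :=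
      exists_of_normCoeff_monomial_mul_pdIter_ne_zero h
    rcases lt_or_ge i a with hia | hai
    · obtain ⟨d, rfl⟩ : ∃ d, a = i + (d + 1) := ⟨a - i - 1, by omega⟩
      exact eventuallyInIdeal_of_gt (a := d) (b := b) (by omega) (by omega) (by omega)
    · obtain ⟨d, rfl⟩ : ∃ d, i = a + d := ⟨i - a, by omega⟩
      exact eventuallyInIdeal_of_le (a := d) (b := b) (by omega) (by omega) (by omega)
  · push Not at h
    exact .of_eventually_zero (.of_forall fun p => h p.1 p.2)

lemma eventuallyInIdeal_eval_mul_pdIter (P : Polynomial QXYZ) (α : Fin 3 → ℕ) :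
    EventuallyInIdeal fun p => normCoeff p.1 p.2 (P.eval ((p.1 + p.2 : ℕ) : QXYZ) *
      pdIter α (X 0 * cuspSum ^ (p.1 + p.2 + 1))) := by
  induction P using Polynomial.induction_on' with
  | add P P' hP hP' =>
    refine (hP.add hP').congr fun p => ?_
    rw [Polynomial.eval_add, add_mul, normCoeff_add]
  | monomial n q =>
    induction q using MvPolynomial.induction_on' with
    | monomial β r =>
      refine ((eventuallyInIdeal_monomial_mul_pdIter α (Finsupp.equivFunOnFinite β)).mul_eval
        (MvPolynomial.C r * (X 0 + X 1) ^ n)).congr fun p => ?_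
      have hr : monomial β r = MvPolynomial.C r * (monomial β 1 : QXYZ) := by
        rw [MvPolynomial.C_mul_monomial, mul_one]
      have hn : ((p.1 + p.2 : ℕ) : QXYZ) = MvPolynomial.C ((p.1 : ℚ) + p.2) := by
        simp
      rw [Polynomial.eval_monomial, hr, hn, ← map_pow,
        mul_right_comm (MvPolynomial.C r), ← map_mul, mul_assoc, normCoeff_C_mul,
        Equiv.symm_apply_apply]
      simp
    | add q q' hq hq' =>
      refine (hq.add hq').congr fun p => ?_
      rw [map_add, Polynomial.eval_add, add_mul, normCoeff_add]

lemma dvd_of_satisfiesBS {b : Polynomial ℚ} (hb : SatisfiesBS cuspSum (X 0) b) :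
    (Polynomial.X + Polynomial.C (5 / 6 : ℚ)) *
      (Polynomial.X + Polynomial.C (1 : ℚ)) *
      (Polynomial.X + Polynomial.C (7 / 6 : ℚ)) ^ 2 *
      (Polynomial.X + Polynomial.C (3 / 2 : ℚ)) *
      (Polynomial.X + Polynomial.C (11 / 6 : ℚ)) ∣ b := by
  obtain ⟨A, P, hP⟩ := hb
  obtain ⟨U, V, h⟩ : EventuallyInIdeal fun p => b.eval ((p.1 : ℚ) + p.2) := by
    refine (EventuallyInIdeal.sum fun α (_ : α ∈ A) =>
      eventuallyInIdeal_eval_mul_pdIter (P α) α).congr fun p => ?_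
    rw [← normCoeff_sum, ← hP, mul_assoc, normCoeff_C_mul, normCoeff_X_mul_cuspSum_pow, mul_one]
    push_cast
    rfl
  obtain ⟨⟨M, N⟩, h⟩ := eventually_atTop.1 h
  have key : Polynomial.aeval (X 0 + X 1 : MvPolynomial (Fin 2) ℚ) b = (X 0 + X 1 + 1) *
      ((2 * X 1 + 1) * U +
        (3 * X 0 + 1) * (3 * X 0 + 2) ^ 2 * (3 * X 0 + 3) * (3 * X 0 + 4) * V) := by
    refine MvPolynomial.funext_set ![Set.image Nat.cast (Set.Ici M),
      Set.image Nat.cast (Set.Ici N)] ?_ ?_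
    · intro j
      fin_cases j <;> exact (Set.Ici_infinite _).image Nat.cast_injective.injOn
    · intro v hv
      obtain ⟨i, hi, hiv⟩ := hv 0 trivial
      obtain ⟨k, hk, hkv⟩ := hv 1 trivial
      have := h (i, k) ⟨hi, hk⟩
      obtain rfl : ![(i : ℚ), (k : ℚ)] = v := by
        ext j
        fin_cases j <;> assumption
      simpa [eval_aeval] using this
  have h := congrArg (MvPolynomial.aeval ![Polynomial.X + Polynomial.C (1 / 2 : ℚ),
    Polynomial.C (-1 / 2 : ℚ)]) key
  rw [← Polynomial.aeval_algHom_apply] at h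
  simp only [map_mul, map_add, map_pow, MvPolynomial.aeval_X, map_ofNat, map_one,
    Matrix.cons_val_zero, Matrix.cons_val_one] at h
  rw [add_assoc, ← map_add, show (1 / 2 + -1 / 2 : ℚ) = 0 by norm_num, map_zero, add_zero,
    Polynomial.aeval_X_left_apply] at h
  rw [h]
  refine ⟨243 * MvPolynomial.aeval ![Polynomial.X + Polynomial.C (1 / 2 : ℚ),
    Polynomial.C (-1 / 2 : ℚ)] V, Polynomial.funext fun r => ?_⟩
  simp only [Polynomial.eval_mul, Polynomial.eval_add, Polynomial.eval_pow, Polynomial.eval_X,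
    Polynomial.eval_C, Polynomial.eval_ofNat, Polynomial.eval_one]
  ring

end LowerBound

theorem bernsteinSato_stmt_19 :
    ∀ b : Polynomial ℚ,
      SatisfiesBS ((X 0) ^ 3 * (X 2) ^ 3 + (X 1) ^ 3 * (X 2) ^ 2 + (X 1) ^ 2 : MvPolynomial (Fin 3) ℚ)
          (X 0) b ↔
        (Polynomial.X + Polynomial.C (5 / 6 : ℚ)) *
            (Polynomial.X + Polynomial.C (1 : ℚ)) *
            (Polynomial.X + Polynomial.C (7 / 6 : ℚ)) ^ 2 *
            (Polynomial.X + Polynomial.C (3 / 2 : ℚ)) *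
            (Polynomial.X + Polynomial.C (11 / 6 : ℚ)) ∣ b := by
  exact fun b => ⟨dvd_of_satisfiesBS, satisfiesBS_of_dvd⟩
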